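/- arXiv:1304.2535 — 4 statements merged into one kernel-verified Lean document; each statement's English description precedes it below -/
import Mathlib

section
/- Let G be a finite group and C a cyclic conjugacy class of G with n ≥ 2 elements. If a function η : C × C → ℂ is Ad-invariant, i.e. η(g⁻¹·a·g, b) = η(a, g·b·g⁻¹) for all g ∈ G and a, b ∈ C, then there exist constants λ, μ ∈ ℂ such that η(a, b) = λ·δ_{a,b} + μ for all a, b ∈ C (all off-diagonal values of η coincide and all diagonal values of η coincide); moreover such an η, viewed as the n×n matrix (η(a,b))_{a,b∈C}, is invertible if and only if λ ≠ 0 and λ + n·μ ≠ 0. -/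
noncomputable section

/-- On a finite set with two distinct elements, the matrix `lam • 1 + mu • J`, where `J` is the
all-ones matrix, has a right inverse iff `lam ≠ 0` and `lam + n * mu ≠ 0`. -/
theorem exists_rightInverse_delta_add_const_iff {K α : Type*} [Field K] [DecidableEq α]
    (S : Finset α) {s t : α} (hs : s ∈ S) (ht : t ∈ S) (hst : s ≠ t) (lam mu : K) :
    (∃ ξ : α → α → K, ∀ a ∈ S, ∀ b ∈ S,
        ∑ c ∈ S, ((if a = c then lam else 0) + mu) * ξ c b = if a = b then 1 else 0) ↔
      (lam ≠ 0 ∧ lam + (S.card : K) * mu ≠ 0) := by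
  constructor
  · rintro ⟨ξ, hξ⟩
    refine ⟨?_, ?_⟩
    · rintro rfl
      have h₁ := hξ t ht t ht
      have h₂ := hξ s hs t ht
      simp only [ite_self, if_true, if_neg hst] at h₁ h₂
      exact one_ne_zero (h₁.symm.trans h₂)
    · intro h0
      have h₁ : ∑ a ∈ S, ∑ c ∈ S, ((if a = c then lam else 0) + mu) * ξ c t = 1 := by
        rw [Finset.sum_congr rfl fun a ha => hξ a ha t ht]
        simp [ht]
      rw [Finset.sum_comm] at h₁
      refine one_ne_zero (h₁.symm.trans (Finset.sum_eq_zero fun c hc => ?_))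
      rw [← Finset.sum_mul, Finset.sum_add_distrib, Finset.sum_ite_eq', if_pos hc,
        Finset.sum_const, nsmul_eq_mul, h0, zero_mul]
  · rintro ⟨h₁, h₂⟩
    refine ⟨fun c b => (if c = b then lam⁻¹ else 0) - mu / (lam * (lam + S.card * mu)),
      fun a ha b hb => ?_⟩
    simp only [add_mul, mul_sub, Finset.sum_add_distrib, Finset.sum_sub_distrib, ite_mul, mul_ite,
      zero_mul, mul_zero, Finset.sum_ite_eq, Finset.sum_ite_eq', ha, hb, if_true,
      Finset.sum_const, nsmul_eq_mul]
    generalize hD : lam + (S.card : K) * mu = D at h₂ ⊢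
    split_ifs <;> field_simp <;> rw [← hD] <;> ring

/-- Let `G` be a finite group and `C` a cyclic conjugacy class of `G` with `n ≥ 2` elements
(i.e. there is `t ∈ C` such that conjugation by `t` acts transitively on `C∖{t}`, hence is a
single `(n−1)`-cycle there, and `a ↦ a·t·a⁻¹` is a bijection of `C` onto itself).
If `η : C × C → ℂ` is Ad-invariant, i.e. `η (g⁻¹·a·g) b = η a (g·b·g⁻¹)` for all `g ∈ G` and
`a, b ∈ C`, then there are constants `λ, μ ∈ ℂ` with `η a b = λ·δ_{a,b} + μ` on `C × C`;
moreover the `n×n` matrix `(η a b)_{a,b ∈ C}` is invertible iff `λ ≠ 0` and `λ + n·μ ≠ 0`. -/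
theorem ad_invariant_form_eq_delta_add_const
    {G : Type*} [Group G] [Fintype G] [DecidableEq G] (C : Set G)
    (hclass : ∃ g₀ : G, C = {h | IsConj g₀ h})
    (hn : 2 ≤ C.ncard)
    (hcyclic : ∃ t ∈ C,
      (∀ a ∈ C, a ≠ t → ∀ b ∈ C, b ≠ t → ∃ k : ℕ, (fun c => t * c * t⁻¹)^[k] a = b) ∧
      Set.BijOn (fun a => a * t * a⁻¹) C C)
    (η : G → G → ℂ)
    (hη : ∀ g : G, ∀ a ∈ C, ∀ b ∈ C, η (g⁻¹ * a * g) b = η a (g * b * g⁻¹)) :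
    ∃ lam mu : ℂ,
      (∀ a ∈ C, ∀ b ∈ C, η a b = (if a = b then lam else 0) + mu) ∧
      ((∃ ξ : G → G → ℂ, ∀ a ∈ C, ∀ b ∈ C,
          ∑ c ∈ C.toFinite.toFinset, η a c * ξ c b = if a = b then (1 : ℂ) else 0) ↔
        (lam ≠ 0 ∧ lam + (C.ncard : ℂ) * mu ≠ 0)) := by
  obtain ⟨g₀, rfl⟩ := hclass
  obtain ⟨t, ht, hcyc, -⟩ := hcyclic
  set C : Set G := {h | IsConj g₀ h} with hC
  have hconj (g : G) {a : G} (ha : a ∈ C) : g * a * g⁻¹ ∈ C :=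
    IsConj.trans ha (isConj_iff.2 ⟨g, rfl⟩)
  have hinv (g : G) {a b : G} (ha : a ∈ C) (hb : b ∈ C) :
      η (g * a * g⁻¹) (g * b * g⁻¹) = η a b := by
    rw [← hη g _ (hconj g ha) b hb]
    congr 1
    group
  obtain ⟨s, hs, hst⟩ := Set.exists_ne_of_one_lt_ncard hn t
  have hiter (k : ℕ) : (fun c => t * c * t⁻¹)^[k] s ∈ C ∧
      η t ((fun c => t * c * t⁻¹)^[k] s) = η t s := by
    induction k with
    | zero => exact ⟨hs, rfl⟩
    | succ k ih =>
      rw [Function.iterate_succ_apply']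
      refine ⟨hconj t ih.1, ?_⟩
      have h := hinv t ht ih.1
      rw [mul_inv_cancel_right] at h
      exact h.trans ih.2
  have hval (a : G) (ha : a ∈ C) (b : G) (hb : b ∈ C) :
      η a b = (if a = b then η t t - η t s else 0) + η t s := by
    obtain ⟨g, hg⟩ := isConj_iff.1 (IsConj.trans (IsConj.symm ha) ht)
    rw [← hinv g ha hb, hg]
    split_ifs with hab
    · rw [← hab, hg, sub_add_cancel]
    · have hne : g * b * g⁻¹ ≠ t := by
        rw [← hg]
        intro h
        exact hab (mul_left_cancel (mul_right_cancel h)).symm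
      obtain ⟨k, hk⟩ := hcyc s hs hst _ (hconj g hb) hne
      rw [← hk, (hiter k).2, zero_add]
  refine ⟨η t t - η t s, η t s, hval, ?_⟩
  have hmem (a : G) : a ∈ C.toFinite.toFinset ↔ a ∈ C := Set.Finite.mem_toFinset _
  rw [Set.ncard_eq_toFinset_card C C.toFinite,
    ← exists_rightInverse_delta_add_const_iff C.toFinite.toFinset ((hmem s).2 hs)
      ((hmem t).2 ht) hst]
  refine exists_congr fun ξ => ?_
  simp only [hmem]
  refine forall₂_congr fun a ha => forall₂_congr fun b _ => ?_
  rw [Finset.sum_congr rfl fun c hc => by rw [hval a ha c ((hmem c).1 hc)]]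
end
end

section
/- The operators D₀, D₁, D₂ on the space of complex-valued functions on D₆ satisfy D₁² = 0, D₂² = 0, D₀∘D₁ = D₁∘D₀ = 0, and D₀∘D₂ = D₂∘D₀ = 0. -/
noncomputable section
open DihedralGroup Complex

abbrev D6 := DihedralGroup 6
/-- the reflection `s` -/
def s : D6 := DihedralGroup.sr 0
/-- the rotation `r` of order 6 -/
def rot : D6 := DihedralGroup.r 1
/-- `t = s*r` -/
def t : D6 := s * rot
/-- `x = s*r^3` -/
def x : D6 := s * rot ^ 3
/-- `y = s*r^5` -/
def y : D6 := s * rot ^ 5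
/-- `F` is the space of complex-valued functions on `D₆`. -/
abbrev F := D6 → ℂ

/-- The right-translation operator `(R_a f)(g) = f(g·a)`. -/
def R (a : D6) : Module.End ℂ F := LinearMap.funLeft ℂ ℂ (fun g => g * a)

/-- `ω = exp(iπ/3)`. -/
def ω : ℂ := Complex.exp (Real.pi * Complex.I / 3)

/-- `D₀ = R_t + R_x + R_y`. -/
def D₀ : Module.End ℂ F := R t + R x + R y

/-- `D₁ = ω·R_t + ω³·R_x + ω⁵·R_y`. -/
def D₁ : Module.End ℂ F := ω • R t + ω ^ 3 • R x + ω ^ 5 • R y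

/-- `D₂ = ω⁻¹·R_t + ω⁻³·R_x + ω⁻⁵·R_y`. -/
def D₂ : Module.End ℂ F := ω⁻¹ • R t + (ω ^ 3)⁻¹ • R x + (ω ^ 5)⁻¹ • R y

/-- The Dirac operator `D̸(f₁, f₂) = (−D₀f₁ + D₂f₂, D₁f₁ − D₀f₂)` on `F × F`. -/
def Dir : Module.End ℂ (F × F) :=
  LinearMap.prod (D₂ ∘ₗ LinearMap.snd ℂ F F - D₀ ∘ₗ LinearMap.fst ℂ F F)
    (D₁ ∘ₗ LinearMap.fst ℂ F F - D₀ ∘ₗ LinearMap.snd ℂ F F)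

theorem R_mul_R (a b : D6) : R a * R b = R (a * b) := by
  ext f g
  simp [R, LinearMap.funLeft_apply, mul_assoc]

theorem reflection_sum_mul_eq_zero {a b c a' b' c' : ℂ}
    (h₀ : a * a' + b * b' + c * c' = 0) (h₁ : a * b' + b * c' + c * a' = 0)
    (h₂ : a * c' + b * a' + c * b' = 0) :
    (a • R t + b • R x + c • R y) * (a' • R t + b' • R x + c' • R y) = 0 := by
  have hxx : x * x = t * t := by decide
  have hyy : y * y = t * t := by decide
  have hxy : x * y = t * x := by decide
  have hyt : y * t = t * x := by decide
  have hxt : x * t = t * y := by decide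
  have hyx : y * x = t * y := by decide
  have expand : (a • R t + b • R x + c • R y) * (a' • R t + b' • R x + c' • R y) =
      (a * a' + b * b' + c * c') • R (t * t) + (a * b' + b * c' + c * a') • R (t * x) +
        (a * c' + b * a' + c * b') • R (t * y) := by
    simp only [mul_add, add_mul, smul_mul_smul_comm, R_mul_R, hxx, hyy, hxy, hyt, hxt, hyx]
    module
  rw [expand, h₀, h₁, h₂]
  simp

theorem ω_pow_three : ω ^ 3 = -1 := by
  rw [ω, ← Complex.exp_nat_mul, ← Complex.exp_pi_mul_I]
  congr 1
  push_cast
  ring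

theorem ω_sq : ω ^ 2 = ω - 1 := by
  have hne : ω + 1 ≠ 0 := by
    intro h
    have hre : ω.re = 1 / 2 := by
      have harg : (Real.pi * Complex.I / 3 : ℂ) = ((Real.pi / 3 : ℝ) : ℂ) * Complex.I := by
        push_cast
        ring
      rw [ω, harg, Complex.exp_ofReal_mul_I_re, Real.cos_pi_div_three]
    have h' := congrArg Complex.re h
    rw [Complex.add_re, hre] at h'
    norm_num at h'
  apply mul_left_cancel₀ hne
  linear_combination ω_pow_three

theorem ω_pow_five : ω ^ 5 = 1 - ω := by
  linear_combination ω ^ 2 * ω_pow_three - ω_sq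

theorem ω_inv : ω⁻¹ = 1 - ω := by
  apply inv_eq_of_mul_eq_one_right
  linear_combination -ω_sq

theorem ω_pow_five_inv : (ω ^ 5)⁻¹ = ω := by
  rw [ω_pow_five, ← ω_inv, inv_inv]

theorem D₀_eq : D₀ = (1 : ℂ) • R t + (1 : ℂ) • R x + (1 : ℂ) • R y := by
  simp [D₀]

theorem D₁_eq : D₁ = ω • R t + (-1 : ℂ) • R x + (1 - ω) • R y := by
  rw [D₁, ω_pow_three, ω_pow_five]

theorem D₂_eq : D₂ = (1 - ω) • R t + (-1 : ℂ) • R x + ω • R y := by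
  rw [D₂, ω_pow_three, ω_pow_five_inv, ω_inv, inv_neg_one]

/-- `D₁² = 0`, `D₂² = 0`, `D₀∘D₁ = D₁∘D₀ = 0` and `D₀∘D₂ = D₂∘D₀ = 0`. -/
theorem D_products_vanish :
    D₁ * D₁ = 0 ∧ D₂ * D₂ = 0 ∧
    D₀ * D₁ = 0 ∧ D₁ * D₀ = 0 ∧ D₀ * D₂ = 0 ∧ D₂ * D₀ = 0 := by
  rw [D₀_eq, D₁_eq, D₂_eq]
  refine ⟨?_, ?_, ?_, ?_, ?_, ?_⟩ <;> apply reflection_sum_mul_eq_zero <;>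
    first
    | ring1
    | linear_combination 2 * ω_sq
    | linear_combination -ω_sq
end
end

section
/- The scalar wave operator □ = Σ_{a ∈ C} (2·R_a − R_{a²} − id) on the space F of complex-valued functions on D₆ equals 2·D₀ − 6·id, it is diagonalizable, and its eigenvalues are 0 with multiplicity 2, −12 with multiplicity 2, and −6 with multiplicity 8. -/
noncomputable section
open DihedralGroup Complex

/-- The scalar wave operator `□ = Σ_{a ∈ C} (2·R_a − R_{a²} − id)`. -/
def Box : Module.End ℂ F :=
  ((2 : ℂ) • R t - R (t * t) - 1) + ((2 : ℂ) • R x - R (x * x) - 1)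
    + ((2 : ℂ) • R y - R (y * y) - 1)

/-- The class of an element of `D₆` modulo the subgroup generated by `r²`. -/
def rotSqClass : D6 → ZMod 2 × ZMod 2
  | .r i => (0, i.cast)
  | .sr i => (1, i.cast)

/-- The sums of a function over the cosets of the subgroup generated by `r²`. -/
def classSum : F →ₗ[ℂ] (ZMod 2 × ZMod 2 → ℂ) where
  toFun f k := ∑ g with rotSqClass g = k, f g
  map_add' f f' := by ext k; simp [Finset.sum_add_distrib]
  map_smul' c f := by ext k; simp [Finset.mul_sum]

lemma card_rotSqClass_fiber (k : ZMod 2 × ZMod 2) :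
    (Finset.univ.filter fun g => rotSqClass g = k).card = 3 := by
  revert k; decide

lemma classSum_comp_rotSqClass (a : ZMod 2 × ZMod 2 → ℂ) (k : ZMod 2 × ZMod 2) :
    classSum (fun g => a (rotSqClass g)) k = 3 * a k := by
  change ∑ g with rotSqClass g = k, a (rotSqClass g) = _
  rw [Finset.sum_congr rfl (g := fun _ => a k) (by simp +contextual), Finset.sum_const,
    card_rotSqClass_fiber]
  simp

lemma D₀_apply (f : F) (g : D6) : D₀ f g = classSum f (rotSqClass g + (1, 1)) := by
  have h : ∀ g : D6, (Finset.univ.filter fun h => rotSqClass h = rotSqClass g + (1, 1)) =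
      {g * t, g * x, g * y} := by decide
  have htx : ∀ g : D6, g * t ≠ g * x ∧ g * t ≠ g * y ∧ g * x ≠ g * y := by decide
  change f (g * t) + f (g * x) + f (g * y) = ∑ h with rotSqClass h = _, f h
  obtain ⟨h₁, h₂, h₃⟩ := htx g
  rw [h, Finset.sum_insert (by simp [h₁, h₂]), Finset.sum_pair h₃, add_assoc]

lemma D₀_D₀_apply (f : F) (g : D6) : D₀ (D₀ f) g = 3 * classSum f (rotSqClass g) := by
  have h : ∀ k : ZMod 2 × ZMod 2, k + (1, 1) + (1, 1) = k := by decide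
  rw [D₀_apply, funext (D₀_apply f), classSum_comp_rotSqClass fun k => classSum f (k + (1, 1)), h]

lemma D₀_D₀_D₀ (f : F) : D₀ (D₀ (D₀ f)) = (9 : ℂ) • D₀ f := by
  ext g
  rw [D₀_apply, funext (D₀_D₀_apply f), Pi.smul_apply, D₀_apply,
    classSum_comp_rotSqClass fun k => 3 * classSum f k, smul_eq_mul]
  ring

lemma Box_eq : Box = (2 : ℂ) • D₀ - (6 : ℂ) • (1 : Module.End ℂ F) := by
  have h : t * t = 1 ∧ x * x = 1 ∧ y * y = 1 := by decide
  have hR : R 1 = 1 := by ext; simp [R, LinearMap.funLeft]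
  rw [Box, D₀, h.1, h.2.1, h.2.2, hR]
  module

lemma mem_eigenspace_Box {μ : ℂ} {f : F} :
    f ∈ Module.End.eigenspace Box μ ↔ D₀ f = ((μ + 6) / 2) • f := by
  rw [Module.End.mem_eigenspace_iff, Box_eq]
  simp only [LinearMap.sub_apply, LinearMap.smul_apply, Module.End.one_apply, funext_iff,
    Pi.sub_apply, Pi.smul_apply, smul_eq_mul]
  refine forall_congr' fun g => ⟨fun h => ?_, fun h => ?_⟩
  · linear_combination h / 2
  · linear_combination 2 * h

/-- For `ε = ±1`, a parametrization of the `3ε`-eigenspace of `D₀`. -/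
def signedExtension (ε : ℂ) : (ZMod 2 → ℂ) →ₗ[ℂ] F where
  toFun b g := (if (rotSqClass g).1 = 0 then 1 else ε) * b ((rotSqClass g).1 + (rotSqClass g).2)
  map_add' b b' := by ext g; simp [mul_add]
  map_smul' c b := by ext g; simp [mul_left_comm]

lemma signedExtension_injective (ε : ℂ) : Function.Injective (signedExtension ε) := by
  intro b b' h
  ext i
  have hi := congrFun h (.r i.cast)
  have hc : ∀ i : ZMod 2, rotSqClass (.r i.cast) = (0, i) := by decide
  simpa [signedExtension, hc] using hi

lemma finrank_eigenspace_Box {ε : ℂ} (hε : ε * ε = 1) :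
    Module.finrank ℂ (Module.End.eigenspace Box (6 * ε - 6)) = 2 := by
  have h : Module.End.eigenspace Box (6 * ε - 6) = LinearMap.range (signedExtension ε) := by
    ext f
    rw [mem_eigenspace_Box, show (6 * ε - 6 + 6) / 2 = 3 * ε by ring]
    constructor
    · intro hf
      have hg (g : D6) : f g = ε / 3 * classSum f (rotSqClass g + (1, 1)) := by
        have := congrFun hf g
        rw [D₀_apply, Pi.smul_apply, smul_eq_mul] at this
        linear_combination -f g * hε - ε / 3 * this
      have hS (k : ZMod 2 × ZMod 2) : classSum f k = ε * classSum f (k + (1, 1)) := by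
        conv_lhs => rw [funext hg]
        rw [classSum_comp_rotSqClass fun k => ε / 3 * classSum f (k + (1, 1))]
        ring
      refine ⟨fun i => classSum f (0, i) / 3, funext fun g => ?_⟩
      rw [hg g, div_mul_eq_mul_div, ← hS]
      change (if (rotSqClass g).1 = 0 then 1 else ε) *
        (classSum f (0, (rotSqClass g).1 + (rotSqClass g).2) / 3) = _
      obtain ⟨i, j⟩ := rotSqClass g
      have hi : i = 0 ∨ i = 1 := by revert i; decide
      rcases hi with rfl | rfl
      · simp
      · rw [hS (1, j), Prod.mk_add_mk, show (1 + 1 : ZMod 2) = 0 from rfl, add_comm j 1]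
        simp [mul_div_assoc]
    · rintro ⟨b, rfl⟩
      ext g
      rw [D₀_apply]
      change classSum (fun g => (fun k : ZMod 2 × ZMod 2 =>
        (if k.1 = 0 then 1 else ε) * b (k.1 + k.2)) (rotSqClass g)) _ = 3 * ε *
        ((if (rotSqClass g).1 = 0 then 1 else ε) * b ((rotSqClass g).1 + (rotSqClass g).2))
      rw [classSum_comp_rotSqClass fun k : ZMod 2 × ZMod 2 =>
        (if k.1 = 0 then 1 else ε) * b (k.1 + k.2)]
      obtain ⟨i, j⟩ := rotSqClass g
      have hij : i + 1 + (j + 1) = i + j := by revert i j; decide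
      have hi : i = 0 ∨ i = 1 := by clear hij; revert i; decide
      simp only [Prod.mk_add_mk, hij]
      rcases hi with rfl | rfl
      · simp [mul_assoc]
      · simp only [show (1 + 1 : ZMod 2) = 0 from rfl, one_ne_zero, if_true, if_false]
        linear_combination -3 * b (1 + j) * hε
  rw [h, LinearMap.finrank_range_of_inj (signedExtension_injective ε)]
  simp

lemma classSum_surjective : Function.Surjective classSum := fun a =>
  ⟨fun g => a (rotSqClass g) / 3, funext fun k => by
    rw [classSum_comp_rotSqClass fun k => a k / 3]; ring⟩

lemma finrank_eigenspace_Box_neg_six :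
    Module.finrank ℂ (Module.End.eigenspace Box (-6)) = 8 := by
  have h : Module.End.eigenspace Box (-6) = LinearMap.ker classSum := by
    ext f
    rw [mem_eigenspace_Box, LinearMap.mem_ker]
    simp only [neg_add_cancel, zero_div, zero_smul]
    constructor
    · intro hf
      have hc : ∀ k, ∃ g, rotSqClass g + (1, 1) = k := by decide
      ext k
      obtain ⟨g, rfl⟩ := hc k
      rw [← D₀_apply, hf]
      rfl
    · intro hf
      ext g
      rw [D₀_apply, hf]
      rfl
  have hr := classSum.finrank_range_add_finrank_ker
  rw [LinearMap.range_eq_top.mpr classSum_surjective, finrank_top] at hr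
  simp only [Module.finrank_fintype_fun_eq_card, Fintype.card_prod, ZMod.card,
    DihedralGroup.card] at hr
  rw [h]
  omega

lemma iSup_eigenspace_Box : (⨆ μ : ℂ, Module.End.eigenspace Box μ) = ⊤ := by
  refine eq_top_iff.mpr fun f _ => ?_
  have hf : f = ((1 / 18 : ℂ) • (D₀ (D₀ f) + (3 : ℂ) • D₀ f) +
      (1 / 18 : ℂ) • (D₀ (D₀ f) - (3 : ℂ) • D₀ f)) + (f - (1 / 9 : ℂ) • D₀ (D₀ f)) := by
    module
  rw [hf]
  refine add_mem (add_mem ?_ ?_) ?_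
  · refine Submodule.mem_iSup_of_mem 0 (mem_eigenspace_Box.mpr ?_)
    simp only [map_smul, map_add, D₀_D₀_D₀]
    module
  · refine Submodule.mem_iSup_of_mem (-12) (mem_eigenspace_Box.mpr ?_)
    simp only [map_smul, map_sub, D₀_D₀_D₀]
    module
  · refine Submodule.mem_iSup_of_mem (-6) (mem_eigenspace_Box.mpr ?_)
    simp only [map_smul, map_sub, D₀_D₀_D₀]
    module

lemma eq_of_hasEigenvalue_Box {μ : ℂ} (hμ : Module.End.HasEigenvalue Box μ) :
    μ = 0 ∨ μ = -12 ∨ μ = -6 := by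
  obtain ⟨f, hf, hf₀⟩ := hμ.exists_hasEigenvector
  have h := D₀_D₀_D₀ f
  simp only [mem_eigenspace_Box.mp hf, map_smul, smul_smul] at h
  have hc := smul_left_injective ℂ hf₀ h
  have : μ * ((μ + 12) * (μ + 6)) = 0 := by linear_combination 8 * hc
  simpa [add_eq_zero_iff_eq_neg] using this

lemma hasEigenvalue_of_finrank_ne_zero {T : Module.End ℂ F} {μ : ℂ}
    (h : Module.finrank ℂ (Module.End.eigenspace T μ) ≠ 0) : T.HasEigenvalue μ := by
  rw [Module.End.hasEigenvalue_iff]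
  intro h'
  simp [h'] at h

/-- `□ = 2·D₀ − 6·id`, `□` is diagonalizable, and its eigenvalues are `0` with
multiplicity 2, `−12` with multiplicity 2 and `−6` with multiplicity 8. -/
theorem wave_operator_spectrum :
    Box = (2 : ℂ) • D₀ - (6 : ℂ) • (1 : Module.End ℂ F) ∧
    (⨆ μ : ℂ, Module.End.eigenspace Box μ) = ⊤ ∧
    {μ : ℂ | Module.End.HasEigenvalue Box μ} = {0, -12, -6} ∧
    Module.finrank ℂ ↥(Module.End.eigenspace Box 0) = 2 ∧
    Module.finrank ℂ ↥(Module.End.eigenspace Box (-12)) = 2 ∧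
    Module.finrank ℂ ↥(Module.End.eigenspace Box (-6)) = 8 := by
  have h₀ : Module.finrank ℂ (Module.End.eigenspace Box 0) = 2 := by
    have h := finrank_eigenspace_Box (ε := 1) (by norm_num)
    rwa [show (6 * 1 - 6 : ℂ) = 0 by norm_num] at h
  have h₁₂ : Module.finrank ℂ (Module.End.eigenspace Box (-12)) = 2 := by
    have h := finrank_eigenspace_Box (ε := -1) (by norm_num)
    rwa [show (6 * (-1) - 6 : ℂ) = -12 by norm_num] at h
  refine ⟨Box_eq, iSup_eigenspace_Box, ?_, h₀, h₁₂, finrank_eigenspace_Box_neg_six⟩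
  refine Set.Subset.antisymm (fun μ hμ => eq_of_hasEigenvalue_Box hμ) ?_
  rintro μ (rfl | rfl | rfl) <;> refine hasEigenvalue_of_finrank_ne_zero ?_
  · simp [h₀]
  · simp [h₁₂]
  · simp [finrank_eigenspace_Box_neg_six]
end
end

section
/- Let α, β, γ : D₆ → ℂ be functions satisfying α + β + γ = −1 (the constant function) together with the three Ricci-flatness equations: (i) −2α + β + γ + ∂ᵗβ + ∂ᵗγ − 2∂ˣβ + ∂ˣα + ∂ʸα − 2∂ʸγ = 0; (ii) α − 2β + γ + ∂ˣα + ∂ˣβ + ∂ᵗβ − 2∂ᵗγ + ∂ʸγ − 2∂ʸα = 0; (iii) α + β − 2γ + ∂ʸα + ∂ʸγ + ∂ᵗγ − 2∂ᵗβ + ∂ˣβ − 2∂ˣα = 0. Then α = β = γ = −1/3 (constant functions). -/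
noncomputable section
open DihedralGroup Complex

/-- The finite-difference derivative `∂ᵃf = R_a f − f`. -/
def pd (a : D6) (f : F) : F := R a f - f

/-- If `α, β, γ : D₆ → ℂ` satisfy `α + β + γ = −1` together with the three Ricci-flatness
equations, then `α = β = γ = −1/3` (constant functions). -/
theorem ricci_flat_unique (α β γ : F)
    (hsum : α + β + γ = fun _ => (-1 : ℂ))
    (h1 : (-2 : ℂ) • α + β + γ + pd t β + pd t γ - (2 : ℂ) • pd x β + pd x α + pd y α
      - (2 : ℂ) • pd y γ = 0)
    (h2 : α - (2 : ℂ) • β + γ + pd x α + pd x β + pd t β - (2 : ℂ) • pd t γ + pd y γ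
      - (2 : ℂ) • pd y α = 0)
    (h3 : α + β - (2 : ℂ) • γ + pd y α + pd y γ + pd t γ - (2 : ℂ) • pd t β + pd x β
      - (2 : ℂ) • pd x α = 0) :
    α = (fun _ => (-1/3 : ℂ)) ∧ β = (fun _ => (-1/3 : ℂ)) ∧ γ = (fun _ => (-1/3 : ℂ)) := by
  have ht : t = sr 1 := by decide
  have hx : x = sr 3 := by decide
  have hy : y = sr 5 := by decide
  -- The equations on the coset `g * ⟨t, x⟩` form a closed nonsingular linear system.
  have key (g : D6) : α g = -1/3 ∧ β g = -1/3 ∧ γ g = -1/3 := by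
    have e0 (h : D6) := congrFun hsum (g * h)
    have e1 (h : D6) := congrFun h1 (g * h)
    have e2 (h : D6) := congrFun h2 (g * h)
    have e3 (h : D6) := congrFun h3 (g * h)
    simp only [pd, R, ht, hx, hy, Pi.add_apply, Pi.sub_apply, Pi.smul_apply, Pi.zero_apply,
      LinearMap.funLeft_apply, smul_eq_mul, mul_assoc g] at e0 e1 e2 e3
    have hq (h : D6) := And.intro (e0 h) (And.intro (e1 h) (And.intro (e2 h) (e3 h)))
    have q0 := hq (r 0)
    have q1 := hq (r 2)
    have q2 := hq (r 4)
    have q3 := hq (sr 1)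
    have q4 := hq (sr 3)
    have q5 := hq (sr 5)
    simp only [r_mul_sr, sr_mul_sr] at q0 q1 q2 q3 q4 q5
    reduce_mod_char at q0 q1 q2 q3 q4 q5
    rw [show g = g * r 0 from (mul_one g).symm]
    clear hq e0 e1 e2 e3 h1 h2 h3 hsum
    generalize g * r 0 = a0 at *
    generalize g * r 2 = a2 at *
    generalize g * r 4 = a4 at *
    grind
  exact ⟨funext fun g => (key g).1, funext fun g => (key g).2.1, funext fun g => (key g).2.2⟩
end
end
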